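/- arXiv:1910.09161 — 2 statements merged into one kernel-verified Lean document; each statement's English description precedes it below -/
import Mathlib

section
/- Fix ω, x, x' ∈ ℝ^r and let u be uniformly distributed on [0, 2π]. Then the random variable Y = 2 cos(ωᵀx + u) cos(ωᵀx' + u) has mean cos(ωᵀ(x − x')) and variance Var(Y) = 1/2. -/
open MeasureTheory Real Set
open scoped Matrix

/-- The integral of a phase-shifted cosine over `[0, 2π]` vanishes at every nonzero integer
frequency. -/
theorem integral_cos_natCast_mul_add {n : ℕ} (hn : n ≠ 0) (c : ℝ) :
    ∫ u in (0 : ℝ)..2 * π, Real.cos (n * u + c) = 0 := by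
  have hn' : (n : ℝ) ≠ 0 := Nat.cast_ne_zero.mpr hn
  rw [intervalIntegral.integral_comp_mul_add (fun t => Real.cos t) hn' c, integral_cos,
    add_comm _ c, Real.sin_add_nat_mul_two_pi]
  simp

/-- The integral against the uniform distribution on `[0, 2π]` as a normalized interval integral. -/
theorem integral_uniform_Icc_two_pi (f : ℝ → ℝ) :
    ∫ u, f u ∂((ENNReal.ofReal (2 * π))⁻¹ • volume.restrict (Icc (0 : ℝ) (2 * π))) =
      (2 * π)⁻¹ * ∫ u in (0 : ℝ)..2 * π, f u := by
  rw [integral_smul_measure, integral_Icc_eq_integral_Ioc,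
    ← intervalIntegral.integral_of_le two_pi_pos.le, ENNReal.toReal_inv,
    ENNReal.toReal_ofReal two_pi_pos.le, smul_eq_mul]

/-- For fixed `ω, x, x' ∈ ℝ^r` and `u ∼ Uniform[0, 2π]`, the random variable
`Y = 2 cos(ωᵀx + u) cos(ωᵀx' + u)` has mean `cos(ωᵀ(x − x'))` and variance `1/2`. -/
theorem phase_shifted_feature_mean_variance {r : ℕ} (ω x x' : Fin r → ℝ)
    (ν : Measure ℝ)
    (hν : ν = (ENNReal.ofReal (2 * π))⁻¹ • volume.restrict (Icc (0 : ℝ) (2 * π)))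
    (Y : ℝ → ℝ)
    (hY : ∀ u, Y u = 2 * Real.cos (ω ⬝ᵥ x + u) * Real.cos (ω ⬝ᵥ x' + u)) :
    (∫ u, Y u ∂ν = Real.cos (ω ⬝ᵥ (x - x'))) ∧
      ProbabilityTheory.variance Y ν = 1 / 2 := by
  have hY' : Y = fun u =>
      Real.cos (ω ⬝ᵥ (x - x')) + Real.cos ((2 : ℕ) * u + (ω ⬝ᵥ x + ω ⬝ᵥ x')) := by
    funext u
    rw [hY, Real.two_mul_cos_mul_cos, dotProduct_sub]
    push_cast
    ring_nf
  have hmean : ∫ u, Y u ∂ν = Real.cos (ω ⬝ᵥ (x - x')) := by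
    rw [hν, integral_uniform_Icc_two_pi, hY', intervalIntegral.integral_add
      intervalIntegrable_const (Continuous.intervalIntegrable (by fun_prop) _ _),
      integral_cos_natCast_mul_add two_ne_zero, intervalIntegral.integral_const]
    simp only [sub_zero, smul_eq_mul, add_zero]
    field_simp
  have hdev : ∀ u, (Y u - Real.cos (ω ⬝ᵥ (x - x'))) ^ 2 =
      1 / 2 + Real.cos ((4 : ℕ) * u + 2 * (ω ⬝ᵥ x + ω ⬝ᵥ x')) / 2 := by
    intro u
    rw [hY', add_sub_cancel_left, Real.cos_sq]
    push_cast
    ring_nf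
  have hmeas : Measurable Y := by
    rw [hY']
    fun_prop
  refine ⟨hmean, ?_⟩
  rw [ProbabilityTheory.variance_eq_integral hmeas.aemeasurable, hmean]
  simp_rw [hdev]
  rw [hν, integral_uniform_Icc_two_pi, intervalIntegral.integral_add
    intervalIntegrable_const (Continuous.intervalIntegrable (by fun_prop) _ _),
    intervalIntegral.integral_const, intervalIntegral.integral_div,
    integral_cos_natCast_mul_add four_ne_zero]
  simp only [sub_zero, smul_eq_mul, zero_div, add_zero]
  field_simp
end

section
/- (Proposition 2.) Let 𝒳 ⊂ ℝ^{d+1} be a compact set contained in a Euclidean ball of radius R, let p be a probability density on ℝ^{d+1} with finite second moment σ_p² = ∫ ‖ω‖² p(ω) dω < ∞, and let ω_1, …, ω_D be i.i.d. with density p. Define K(δ) = ∫ cos(ωᵀδ) p(ω) dω and K̂_D(δ) = (1/D) Σ_{k=1}^D cos(ω_kᵀδ). Then, assuming ε > 0 with ε ≤ 24 R σ_p, ℙ{ sup_{x, x' ∈ 𝒳} | K̂_D(x − x') − K(x − x') | ≥ ε } ≤ (48 R σ_p / ε)² · exp( − D ε² / (4(d+3)) ). -/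
open MeasureTheory Real Set
open scoped RealInnerProductSpace ENNReal

section Covering

open Module Metric

variable {E : Type*} [NormedAddCommGroup E] [NormedSpace ℝ E] [FiniteDimensional ℝ E]

/-- Volume bound for the cardinality of a separated subset of a ball. -/
theorem card_le_of_separated_closedBall {ρ r : ℝ} (hr : 0 < r) (hrρ : r ≤ ρ) (s : Finset E)
    (hs : ∀ c ∈ s, ‖c‖ ≤ ρ) (h : ∀ c ∈ s, ∀ d ∈ s, c ≠ d → r ≤ ‖c - d‖) :
    (s.card : ℝ) ≤ (3 * ρ / r) ^ finrank ℝ E := by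
  borelize E
  let μ : Measure E := Measure.addHaar
  have hr2 : 0 < r / 2 := by positivity
  have hρr : 0 < ρ + r / 2 := by linarith
  have hdisj : Set.Pairwise (s : Set E) (Function.onFun Disjoint fun c => ball (c : E) (r / 2)) := by
    rintro c hc d hd hcd
    apply ball_disjoint_ball
    rw [dist_eq_norm]
    linarith [h c hc d hd hcd]
  have hsub : (⋃ c ∈ s, ball (c : E) (r / 2)) ⊆ ball (0 : E) (ρ + r / 2) := by
    refine iUnion₂_subset fun x hx => ball_subset_ball' ?_
    rw [dist_zero_right]
    linarith [hs x hx]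
  have hvol : (s.card : ℝ≥0∞) * ENNReal.ofReal ((r / 2) ^ finrank ℝ E) * μ (ball 0 1) ≤
      ENNReal.ofReal ((ρ + r / 2) ^ finrank ℝ E) * μ (ball 0 1) :=
    calc
      _ = μ (⋃ c ∈ s, ball (c : E) (r / 2)) := by
        rw [measure_biUnion_finset hdisj fun c _ => measurableSet_ball]
        simp only [μ.addHaar_ball_of_pos _ hr2, Finset.sum_const, nsmul_eq_mul, mul_assoc]
      _ ≤ μ (ball (0 : E) (ρ + r / 2)) := measure_mono hsub
      _ = _ := by simp only [μ.addHaar_ball_of_pos _ hρr]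
  have hvol' : (s.card : ℝ≥0∞) * ENNReal.ofReal ((r / 2) ^ finrank ℝ E) ≤
      ENNReal.ofReal ((ρ + r / 2) ^ finrank ℝ E) :=
    (ENNReal.mul_le_mul_iff_left (measure_ball_pos _ _ zero_lt_one).ne' measure_ball_lt_top.ne).1
      hvol
  have hreal : (s.card : ℝ) * (r / 2) ^ finrank ℝ E ≤ (ρ + r / 2) ^ finrank ℝ E := by
    have := ENNReal.toReal_le_of_le_ofReal (pow_nonneg hρr.le _) hvol'
    rwa [ENNReal.toReal_mul, ENNReal.toReal_natCast,
      ENNReal.toReal_ofReal (pow_nonneg hr2.le _)] at this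
  rw [← le_div_iff₀ (by positivity), ← div_pow] at hreal
  refine hreal.trans (pow_le_pow_left₀ (by positivity) ?_ _)
  rw [div_le_div_iff₀ hr2 hr]
  nlinarith

/-- A closed ball of radius `ρ` has an `r`-net with at most `(3ρ/r)^dim` points. -/
theorem exists_finset_net_closedBall {ρ r : ℝ} (hr : 0 < r) (hrρ : r ≤ ρ) :
    ∃ s : Finset E, (∀ x : E, ‖x‖ ≤ ρ → ∃ y ∈ s, ‖x - y‖ ≤ r) ∧
      (s.card : ℝ) ≤ (3 * ρ / r) ^ finrank ℝ E := by
  classical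
  let A : Set ℕ := {n | ∃ s : Finset E, (∀ c ∈ s, ‖c‖ ≤ ρ) ∧
    (∀ c ∈ s, ∀ d ∈ s, c ≠ d → r ≤ ‖c - d‖) ∧ s.card = n}
  have hne : A.Nonempty := ⟨0, ∅, by simp⟩
  have hbdd : BddAbove A := by
    refine ⟨⌊(3 * ρ / r) ^ finrank ℝ E⌋₊, ?_⟩
    rintro _ ⟨s, hs, hsep, rfl⟩
    exact Nat.le_floor (card_le_of_separated_closedBall hr hrρ s hs hsep)
  obtain ⟨s, hs, hsep, hcard⟩ := Nat.sSup_mem hne hbdd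
  refine ⟨s, fun x hx => ?_, card_le_of_separated_closedBall hr hrρ s hs hsep⟩
  by_contra! hfar
  have hxs : x ∉ s := fun hmem => by
    have := hfar x hmem
    simp only [sub_self, norm_zero] at this
    linarith
  have hmem : (insert x s).card ∈ A := by
    refine ⟨insert x s, ?_, ?_, rfl⟩
    · simpa using ⟨hx, hs⟩
    · intro c hc d hd hcd
      rw [Finset.mem_insert] at hc hd
      rcases hc with rfl | hc <;> rcases hd with rfl | hd
      · exact absurd rfl hcd
      · exact (hfar d hd).le
      · rw [norm_sub_rev]
        exact (hfar c hc).le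
      · exact hsep c hc d hd hcd
  have := le_csSup hbdd hmem
  rw [Finset.card_insert_of_notMem hxs] at this
  omega

end Covering

section Concentration

open ProbabilityTheory

variable {Ω : Type*} [MeasurableSpace Ω] {μ : Measure Ω} [IsProbabilityMeasure μ]

/-- One-sided Hoeffding inequality for the empirical mean of a `[-1, 1]`-valued function. -/
theorem measureReal_le_mean_sub_integral_le {g : Ω → ℝ} (hg : Measurable g)
    (hg1 : ∀ x, |g x| ≤ 1) {D : ℕ} (hD : 0 < D) {t : ℝ} (ht : 0 ≤ t) :
    (Measure.pi fun _ : Fin D => μ).real {ω | t ≤ (1 / (D : ℝ)) * ∑ k, g (ω k) - ∫ x, g x ∂μ} ≤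
      exp (-((D : ℝ) * t ^ 2) / 2) := by
  have hD' : (0 : ℝ) < D := by exact_mod_cast hD
  have hsub : HasSubgaussianMGF (fun x => g x - ∫ y, g y ∂μ) 1 μ := by
    have := hasSubgaussianMGF_of_mem_Icc (μ := μ) (X := g) (a := -1) (b := 1) hg.aemeasurable
      (ae_of_all _ fun x => abs_le.1 (hg1 x))
    convert this
    rw [← NNReal.coe_inj]
    norm_num
  have hsub' : ∀ k ∈ (Finset.univ : Finset (Fin D)),
      HasSubgaussianMGF (fun ω : Fin D → Ω => g (ω k) - ∫ y, g y ∂μ) 1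
        (Measure.pi fun _ : Fin D => μ) := by
    intro k _
    refine HasSubgaussianMGF.of_map (Y := fun ω : Fin D → Ω => ω k)
      (X := fun x => g x - ∫ y, g y ∂μ) (measurable_pi_apply k).aemeasurable ?_
    rwa [(measurePreserving_eval (fun _ : Fin D => μ) k).map_eq]
  have hindep := iIndepFun_pi (μ := fun _ : Fin D => μ)
    (X := fun _ x => g x - ∫ y, g y ∂μ) (fun _ => (hg.sub_const _).aemeasurable)
  have key := HasSubgaussianMGF.measure_sum_ge_le_of_iIndepFun hindep (c := fun _ => 1)
    (s := Finset.univ) hsub' (ε := D * t) (by positivity)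
  refine (measureReal_mono ?_).trans (key.trans (le_of_eq ?_))
  · intro ω hω
    simp only [mem_ofPred_eq, Finset.sum_sub_distrib, Finset.sum_const, Finset.card_univ,
      Fintype.card_fin, nsmul_eq_mul] at hω ⊢
    have h2 := mul_le_mul_of_nonneg_left hω hD'.le
    have h3 : (D : ℝ) * ((1 / (D : ℝ)) * ∑ k, g (ω k) - ∫ x, g x ∂μ) =
      ∑ k, g (ω k) - D * ∫ x, g x ∂μ := by field_simp
    linarith
  · congr 1
    simp
    field_simp

/-- Two-sided Hoeffding inequality for the empirical mean of a `[-1, 1]`-valued function. -/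
theorem measureReal_le_abs_mean_sub_integral_le {g : Ω → ℝ} (hg : Measurable g)
    (hg1 : ∀ x, |g x| ≤ 1) {D : ℕ} (hD : 0 < D) {t : ℝ} (ht : 0 ≤ t) :
    (Measure.pi fun _ : Fin D => μ).real {ω | t ≤ |(1 / (D : ℝ)) * ∑ k, g (ω k) - ∫ x, g x ∂μ|} ≤
      2 * exp (-((D : ℝ) * t ^ 2) / 2) := by
  have h1 := measureReal_le_mean_sub_integral_le (μ := μ) hg hg1 hD ht
  have h2 := measureReal_le_mean_sub_integral_le (μ := μ) hg.neg (by simpa using hg1) hD ht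
  refine (measureReal_mono ?_).trans ((measureReal_union_le _ _).trans
    ((add_le_add h1 h2).trans_eq (two_mul _).symm))
  intro ω hω
  rcases le_abs.1 (mem_ofPred_eq ▸ hω) with h | h
  · exact Or.inl h
  · refine Or.inr ?_
    simp only [mem_ofPred_eq, Pi.neg_apply, Finset.sum_neg_distrib, integral_neg]
    linarith

/-- Markov's inequality for an empirical mean added to its expectation. -/
theorem measureReal_le_mean_add_integral_le {q : Ω → ℝ} (hq0 : ∀ x, 0 ≤ q x)
    (hq : Integrable q μ) {D : ℕ} (hD : 0 < D) {t : ℝ} (ht : 0 < t) :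
    (Measure.pi fun _ : Fin D => μ).real
      {ω | t ≤ 2 * ((1 / (D : ℝ)) * ∑ k, q (ω k)) + 2 * ∫ x, q x ∂μ} ≤ 4 * (∫ x, q x ∂μ) / t := by
  have hD' : (D : ℝ) ≠ 0 := by exact_mod_cast hD.ne'
  have hint : ∀ k ∈ (Finset.univ : Finset (Fin D)),
      Integrable (fun ω : Fin D → Ω => q (ω k)) (Measure.pi fun _ : Fin D => μ) :=
    fun k _ => (measurePreserving_eval (fun _ : Fin D => μ) k).integrable_comp_of_integrable hq
  have hval : ∀ k : Fin D, ∫ ω : Fin D → Ω, q (ω k) ∂(Measure.pi fun _ : Fin D => μ) =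
      ∫ x, q x ∂μ := fun k =>
    integral_comp_eval (μ := fun _ : Fin D => μ) (i := k) hq.aestronglyMeasurable
  have hI : Integrable (fun ω : Fin D → Ω =>
      2 * ((1 / (D : ℝ)) * ∑ k, q (ω k)) + 2 * ∫ x, q x ∂μ) (Measure.pi fun _ : Fin D => μ) :=
    (((integrable_finsetSum _ hint).const_mul _).const_mul _).add (integrable_const _)
  have hm0 : 0 ≤ ∫ x, q x ∂μ := integral_nonneg hq0
  have key := mul_meas_ge_le_integral_of_nonneg (ae_of_all _ fun ω => by
    have : 0 ≤ ∑ k, q (ω k) := Finset.sum_nonneg fun k _ => hq0 _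
    simp only [Pi.zero_apply]
    positivity) hI t
  rw [integral_add (((integrable_finsetSum _ hint).const_mul _).const_mul _)
    (integrable_const _), integral_const_mul, integral_const_mul, integral_finsetSum _ hint,
    Finset.sum_congr rfl fun k _ => hval k] at key
  simp only [Finset.sum_const, Finset.card_univ, Fintype.card_fin, nsmul_eq_mul, integral_const,
    probReal_univ, smul_eq_mul, one_mul] at key
  rw [le_div_iff₀ ht, mul_comm]
  refine key.trans_eq ?_
  field_simp
  ring

theorem sq_integral_le_integral_sq {f : Ω → ℝ} (hf : MemLp f 2 μ) :
    (∫ x, f x ∂μ) ^ 2 ≤ ∫ x, f x ^ 2 ∂μ := by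
  have h := variance_nonneg f μ
  rw [variance_eq_sub hf] at h
  simpa using h

end Concentration

section RandomFourier

variable {E : Type*} [NormedAddCommGroup E] [InnerProductSpace ℝ E]

theorem sq_cos_inner_sub_le (w δ δ' : E) :
    (cos ⟪w, δ⟫ - cos ⟪w, δ'⟫) ^ 2 ≤ ‖w‖ ^ 2 * ‖δ - δ'‖ ^ 2 := by
  rw [← mul_pow, ← sq_abs]
  refine pow_le_pow_left₀ (abs_nonneg _) ?_ 2
  refine (abs_cos_sub_cos_le _ _).trans ?_
  rw [← inner_sub_right]
  exact abs_real_inner_le_norm _ _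

variable [MeasurableSpace E] {μ : Measure E} [IsProbabilityMeasure μ]

/-- The error of the random Fourier feature estimator built from the frequencies `ω`. -/
noncomputable def fourierError (μ : Measure E) {D : ℕ} (ω : Fin D → E) (δ : E) : ℝ :=
  (1 / (D : ℝ)) * ∑ k, cos ⟪ω k, δ⟫ - ∫ w, cos ⟪w, δ⟫ ∂μ

theorem fourierError_zero {D : ℕ} (hD : 0 < D) (ω : Fin D → E) : fourierError μ ω 0 = 0 := by
  have hD' : (D : ℝ) ≠ 0 := by exact_mod_cast hD.ne'
  simp [fourierError, hD']

variable [BorelSpace E] [SecondCountableTopology E]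

theorem integrable_cos_inner (δ : E) : Integrable (fun w => cos ⟪w, δ⟫) μ :=
  Integrable.of_bound (by fun_prop) 1 (ae_of_all _ fun w => by
    simpa using abs_cos_le_one ⟪w, δ⟫)

/-- A random Lipschitz bound for the error, in terms of the second moments. -/
theorem sq_fourierError_sub_le (hμ : Integrable (fun w : E => ‖w‖ ^ 2) μ) {D : ℕ} (hD : 0 < D)
    (ω : Fin D → E) (δ δ' : E) :
    (fourierError μ ω δ - fourierError μ ω δ') ^ 2 ≤
      (2 * ((1 / (D : ℝ)) * ∑ k, ‖ω k‖ ^ 2) + 2 * ∫ w, ‖w‖ ^ 2 ∂μ) * ‖δ - δ'‖ ^ 2 := by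
  have hD' : (0 : ℝ) < D := by exact_mod_cast hD
  have hmean : ((1 / (D : ℝ)) * ∑ k, (cos ⟪ω k, δ⟫ - cos ⟪ω k, δ'⟫)) ^ 2 ≤
      (1 / (D : ℝ)) * ∑ k, ‖ω k‖ ^ 2 * ‖δ - δ'‖ ^ 2 := by
    have h1 := sq_sum_le_card_mul_sum_sq (s := (Finset.univ : Finset (Fin D)))
      (f := fun k => cos ⟪ω k, δ⟫ - cos ⟪ω k, δ'⟫)
    have h2 := Finset.sum_le_sum fun k (_ : k ∈ (Finset.univ : Finset (Fin D))) =>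
      sq_cos_inner_sub_le (ω k) δ δ'
    rw [Finset.card_univ, Fintype.card_fin] at h1
    calc _ = (1 / (D : ℝ)) ^ 2 * (∑ k, (cos ⟪ω k, δ⟫ - cos ⟪ω k, δ'⟫)) ^ 2 := mul_pow _ _ _
      _ ≤ (1 / (D : ℝ)) ^ 2 * (D * ∑ k, ‖ω k‖ ^ 2 * ‖δ - δ'‖ ^ 2) := by
        gcongr
        exact h1.trans (by gcongr)
      _ = _ := by
        rw [← mul_assoc]
        congr 1
        field_simp
  have hint : (∫ w, (cos ⟪w, δ⟫ - cos ⟪w, δ'⟫) ∂μ) ^ 2 ≤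
      (∫ w, ‖w‖ ^ 2 ∂μ) * ‖δ - δ'‖ ^ 2 := by
    have hL : MemLp (fun w : E => cos ⟪w, δ⟫ - cos ⟪w, δ'⟫) 2 μ :=
      MemLp.of_bound (by fun_prop) 2 (ae_of_all _ fun w => by
        rw [norm_eq_abs, abs_le]
        constructor <;> linarith [neg_one_le_cos ⟪w, δ⟫, neg_one_le_cos ⟪w, δ'⟫,
          cos_le_one ⟪w, δ⟫, cos_le_one ⟪w, δ'⟫])
    refine (sq_integral_le_integral_sq hL).trans ?_
    rw [← integral_mul_const]
    exact integral_mono hL.integrable_sq (hμ.mul_const _) fun w => sq_cos_inner_sub_le w δ δ'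
  have hsplit : fourierError μ ω δ - fourierError μ ω δ' =
      (1 / (D : ℝ)) * ∑ k, (cos ⟪ω k, δ⟫ - cos ⟪ω k, δ'⟫) -
        ∫ w, (cos ⟪w, δ⟫ - cos ⟪w, δ'⟫) ∂μ := by
    rw [integral_sub (integrable_cos_inner δ) (integrable_cos_inner δ'), Finset.sum_sub_distrib,
      fourierError, fourierError]
    ring
  rw [← Finset.sum_mul] at hmean
  rw [hsplit]
  set a := (1 / (D : ℝ)) * ∑ k, (cos ⟪ω k, δ⟫ - cos ⟪ω k, δ'⟫)
  set b := ∫ w, (cos ⟪w, δ⟫ - cos ⟪w, δ'⟫) ∂μ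
  nlinarith [sq_nonneg (a + b)]

/-- Rahimi–Recht uniform bound for random Fourier features over a centred ball. -/
theorem measureReal_fourierError_le [FiniteDimensional ℝ E]
    (hμ : Integrable (fun w : E => ‖w‖ ^ 2) μ) {D : ℕ} (hD : 0 < D) {R ε sp : ℝ} (hR : 0 < R)
    (hε : 0 < ε) (hsp : sp ^ 2 = ∫ w, ‖w‖ ^ 2 ∂μ) (hε' : ε ≤ 24 * R * sp)
    {S : Set (Fin D → E)}
    (hS : ∀ ω ∈ S, ∀ a, 0 ≤ a → (∀ δ, ‖δ‖ ≤ 2 * R → |fourierError μ ω δ| ≤ a) → ε ≤ a) :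
    (Measure.pi fun _ : Fin D => μ).real S ≤
      (48 * R * sp / ε) ^ 2 *
        exp (-((D : ℝ) * ε ^ 2) / (4 * ((Module.finrank ℝ E : ℝ) + 2))) := by
  set n := Module.finrank ℝ E
  set P := Measure.pi fun _ : Fin D => μ
  set s : ℝ := exp (-((D : ℝ) * ε ^ 2) / (8 * ((n : ℝ) + 2))) with hs
  have hs0 : 0 < s := exp_pos _
  have hs2 : exp (-((D : ℝ) * ε ^ 2) / (4 * ((n : ℝ) + 2))) = s ^ 2 := by
    rw [hs, ← exp_nat_mul]
    congr 1
    push_cast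
    field_simp
    ring
  have hsn : exp (-((D : ℝ) * (ε / 2) ^ 2) / 2) = s ^ (n + 2) := by
    rw [hs, ← exp_nat_mul]
    congr 1
    push_cast
    field_simp
    ring
  set b : ℝ := R * sp / ε with hb
  have hb24 : 1 / 24 ≤ b := by
    rw [hb, le_div_iff₀ hε]
    linarith
  rw [hs2, show 48 * R * sp / ε = 48 * b by rw [hb]; ring]
  set G : (Fin D → E) → ℝ := fun ω =>
    2 * ((1 / (D : ℝ)) * ∑ k, ‖ω k‖ ^ 2) + 2 * ∫ w, ‖w‖ ^ 2 ∂μ with hG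
  have hG0 : ∀ ω, 0 ≤ G ω := fun ω => by
    have : 0 ≤ ∫ w, ‖w‖ ^ 2 ∂μ := integral_nonneg fun w => by positivity
    simp only [hG]
    positivity
  have hlip : ∀ ω δ δ' r, ‖δ - δ'‖ ≤ r →
      |fourierError μ ω δ - fourierError μ ω δ'| ≤ √(G ω) * r := by
    intro ω δ δ' r hr
    refine le_trans ?_ (mul_le_mul_of_nonneg_left hr (sqrt_nonneg _))
    refine abs_le_of_sq_le_sq ?_ (by positivity)
    rw [mul_pow, sq_sqrt (hG0 ω)]
    exact sq_fourierError_sub_le hμ hD ω δ δ'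
  have hmarkov : ∀ t, 0 < t → P.real {ω | t ≤ G ω} ≤ 4 * sp ^ 2 / t := fun t ht => by
    rw [hsp]
    exact measureReal_le_mean_add_integral_le (fun w => by positivity) hμ hD ht
  rcases le_or_gt (1 / 3) s with hs3 | hs3
  · have hsub : S ⊆ {ω | (ε / (2 * R)) ^ 2 ≤ G ω} := by
      intro ω hω
      have h := hS ω hω (√(G ω) * (2 * R)) (by positivity) fun δ hδ => by
        have := hlip ω δ 0 (2 * R) (by simpa using hδ)
        rwa [fourierError_zero hD, sub_zero] at this
      rw [← div_le_iff₀ (by positivity)] at h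
      exact (le_sqrt (by positivity) (hG0 ω)).1 h
    have h1 := (measureReal_mono hsub).trans (hmarkov _ (by positivity))
    have h2 : 4 * sp ^ 2 / (ε / (2 * R)) ^ 2 = 16 * b ^ 2 := by
      rw [hb]
      field_simp
      ring
    rw [h2] at h1
    have h3 : (1 / 3) ^ 2 ≤ s ^ 2 := pow_le_pow_left₀ (by norm_num) hs3 2
    nlinarith [sq_nonneg b]
  · set r : ℝ := 6 * R * s with hr
    have hr0 : 0 < r := by positivity
    obtain ⟨T, hT, hcard⟩ := exists_finset_net_closedBall (E := E) (ρ := 2 * R) hr0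
      (by rw [hr]; nlinarith)
    have hcard' : (T.card : ℝ) * s ^ n ≤ 1 := by
      calc (T.card : ℝ) * s ^ n ≤ (3 * (2 * R) / r) ^ n * s ^ n := by gcongr
        _ = 1 := by
          rw [← mul_pow, show 3 * (2 * R) / r * s = 1 by rw [hr]; field_simp; norm_num, one_pow]
    have hsub : S ⊆ (⋃ y ∈ T, {ω | ε / 2 ≤ |fourierError μ ω y|}) ∪
        {ω | (ε / (2 * r)) ^ 2 ≤ G ω} := by
      intro ω hω
      by_contra hcon
      simp only [mem_union, mem_iUnion, mem_ofPred_eq, not_or, not_exists, not_le] at hcon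
      obtain ⟨hnet, hsmall⟩ := hcon
      have hL : √(G ω) * r < ε / 2 := by
        have : √(G ω) < ε / (2 * r) := (sqrt_lt' (by positivity)).2 hsmall
        calc √(G ω) * r < ε / (2 * r) * r := by gcongr
          _ = ε / 2 := by field_simp
      obtain ⟨m, hm0, hm, hmax⟩ : ∃ m, 0 ≤ m ∧ m < ε / 2 ∧
          ∀ y ∈ T, |fourierError μ ω y| ≤ m := by
        obtain ⟨y0, hy0, -⟩ := hT 0 (by simpa using hR.le)
        obtain ⟨y, hy, hmax⟩ := T.exists_max_image (fun y => |fourierError μ ω y|) ⟨y0, hy0⟩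
        exact ⟨_, abs_nonneg _, hnet y hy, hmax⟩
      have := hS ω hω (m + √(G ω) * r) (by positivity) fun δ hδ => by
        obtain ⟨y, hy, hyd⟩ := hT δ hδ
        have h1 := hlip ω δ y r hyd
        have h2 := abs_sub_abs_le_abs_sub (fourierError μ ω δ) (fourierError μ ω y)
        linarith [hmax y hy]
      linarith
    have hhoeff : ∀ y ∈ T, P.real {ω | ε / 2 ≤ |fourierError μ ω y|} ≤ 2 * s ^ (n + 2) := by
      intro y _
      rw [← hsn]
      exact measureReal_le_abs_mean_sub_integral_le (μ := μ) (g := fun w => cos ⟪w, y⟫)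
        (by fun_prop) (fun w => abs_cos_le_one _) hD (by positivity)
    have h1 : P.real (⋃ y ∈ T, {ω | ε / 2 ≤ |fourierError μ ω y|}) ≤ 2 * s ^ 2 :=
      calc _ ≤ ∑ y ∈ T, P.real {ω | ε / 2 ≤ |fourierError μ ω y|} :=
            measureReal_biUnion_finset_le _ _
        _ ≤ T.card * (2 * s ^ (n + 2)) := by
            simpa using Finset.sum_le_sum hhoeff
        _ = (T.card * s ^ n) * (2 * s ^ 2) := by ring
        _ ≤ 1 * (2 * s ^ 2) := by gcongr
        _ = _ := one_mul _
    have h2 : P.real {ω | (ε / (2 * r)) ^ 2 ≤ G ω} ≤ 576 * b ^ 2 * s ^ 2 := by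
      refine (hmarkov _ (by positivity)).trans_eq ?_
      rw [hb, hr]
      field_simp
      ring
    have h3 : P.real S ≤ 2 * s ^ 2 + 576 * b ^ 2 * s ^ 2 :=
      (measureReal_mono hsub).trans ((measureReal_union_le _ _).trans (add_le_add h1 h2))
    have hb2 : (1 / 24) ^ 2 ≤ b ^ 2 := pow_le_pow_left₀ (by norm_num) hb24 2
    nlinarith [mul_le_mul_of_nonneg_right hb2 (sq_nonneg s)]

end RandomFourier

/-- **Proposition 2 (uniform convergence of the random Fourier kernel approximation).**
Let `𝒳 ⊂ ℝ^{d+1}` be compact and contained in a Euclidean ball of radius `R`, let `p` be a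
probability density on `ℝ^{d+1}` with second moment `σ_p² = ∫ ‖ω‖² p(ω) dω < ∞`, and let
`ω_1, …, ω_D` be i.i.d. with density `p`.  With `K(δ) = ∫ cos(ωᵀδ) p(ω) dω` and
`K̂_D(δ) = (1/D) Σ_k cos(ω_kᵀδ)`, for `0 < ε ≤ 24 R σ_p`,
`ℙ{ sup_{x,x'∈𝒳} |K̂_D(x−x') − K(x−x')| ≥ ε } ≤ (48Rσ_p/ε)² exp(−Dε²/(4(d+3)))`. -/
theorem uniform_convergence_random_fourier {d : ℕ}
    (X : Set (EuclideanSpace ℝ (Fin (d + 1)))) (hX_compact : IsCompact X)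
    (R : ℝ) (hR : 0 < R) (c : EuclideanSpace ℝ (Fin (d + 1)))
    (hXR : X ⊆ Metric.closedBall c R)
    (p : EuclideanSpace ℝ (Fin (d + 1)) → ℝ) (hp_meas : Measurable p)
    (hp_nonneg : ∀ ω, 0 ≤ p ω) (hp_int : ∫ ω, p ω = 1)
    (sp : ℝ) (hsp_nonneg : 0 ≤ sp) (hsp : sp ^ 2 = ∫ ω, ‖ω‖ ^ 2 * p ω)
    (K : EuclideanSpace ℝ (Fin (d + 1)) → ℝ)
    (hK : ∀ δ, K δ = ∫ ω, Real.cos ⟪ω, δ⟫ * p ω)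
    (D : ℕ) (hD : 0 < D)
    (P : Measure (Fin D → EuclideanSpace ℝ (Fin (d + 1))))
    (hP : P = Measure.pi fun _ => volume.withDensity fun ω => ENNReal.ofReal (p ω))
    (ε : ℝ) (hε : 0 < ε) (hε' : ε ≤ 24 * R * sp) :
    P {ωs | ε ≤ ⨆ x ∈ X, ⨆ x' ∈ X,
          |(1 / (D : ℝ)) * ∑ k, Real.cos ⟪ωs k, x - x'⟫ - K (x - x')|} ≤
      ENNReal.ofReal
        ((48 * R * sp / ε) ^ 2 * Real.exp (-((D : ℝ) * ε ^ 2) / (4 * ((d : ℝ) + 3)))) := by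
  set μ : Measure (EuclideanSpace ℝ (Fin (d + 1))) :=
    volume.withDensity fun ω => ENNReal.ofReal (p ω) with hμ
  have hsp_pos : 0 < sp := by
    by_contra hneg
    have : sp = 0 := le_antisymm (not_lt.1 hneg) hsp_nonneg
    rw [this] at hε'
    linarith
  have hp_integrable : Integrable p := by
    by_contra hni
    rw [integral_undef hni] at hp_int
    exact zero_ne_one hp_int
  have hprob : IsProbabilityMeasure μ := by
    refine ⟨?_⟩
    rw [hμ, withDensity_apply _ MeasurableSet.univ, Measure.restrict_univ,
      ← ofReal_integral_eq_lintegral_ofReal hp_integrable (ae_of_all _ hp_nonneg), hp_int,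
      ENNReal.ofReal_one]
  have hintegral : ∀ f : EuclideanSpace ℝ (Fin (d + 1)) → ℝ,
      ∫ ω, f ω ∂μ = ∫ ω, f ω * p ω := by
    intro f
    rw [hμ, integral_withDensity_eq_integral_toReal_smul (by fun_prop)
      (ae_of_all _ fun _ => ENNReal.ofReal_lt_top)]
    refine integral_congr_ae (ae_of_all _ fun ω => ?_)
    simp [ENNReal.toReal_ofReal (hp_nonneg ω), mul_comm]
  have hmoment : sp ^ 2 = ∫ ω, ‖ω‖ ^ 2 ∂μ := by rw [hintegral, hsp]
  have hmoment_int : Integrable (fun ω : EuclideanSpace ℝ (Fin (d + 1)) => ‖ω‖ ^ 2) μ := by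
    by_contra hni
    rw [integral_undef hni] at hmoment
    exact hsp_pos.ne' (by simpa using hmoment)
  have key := measureReal_fourierError_le (μ := μ) hmoment_int hD hR hε hmoment hε'
    (S := {ωs | ε ≤ ⨆ x ∈ X, ⨆ x' ∈ X,
      |(1 / (D : ℝ)) * ∑ k, Real.cos ⟪ωs k, x - x'⟫ - K (x - x')|}) (by
    intro ωs hω a ha hbound
    refine le_trans (mem_ofPred_eq ▸ hω) ?_
    refine Real.iSup_le (fun x => Real.iSup_le (fun hx => Real.iSup_le (fun x' =>
      Real.iSup_le (fun hx' => ?_) ha) ha) ha) ha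
    rw [hK, ← hintegral fun ω => Real.cos ⟪ω, x - x'⟫]
    refine hbound (x - x') ?_
    have h1 := mem_closedBall_iff_norm.1 (hXR hx)
    have h2 := mem_closedBall_iff_norm.1 (hXR hx')
    have h3 := norm_sub_le (x - c) (x' - c)
    rw [sub_sub_sub_cancel_right] at h3
    linarith)
  rw [finrank_euclideanSpace_fin] at key
  rw [hP, ← ofReal_measureReal]
  refine ENNReal.ofReal_le_ofReal (key.trans_eq ?_)
  congr 3
  push_cast
  ring
end
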